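/- Inequalities are preserved by the enlargement: assume rk(M i) < rk(s) for every i : ι. Then for all x, y : ι, if M x ≠ M y, then Mₙ x ≠ Mₙ y for every n ∈ ℕ. -/

import Mathlib

-- The recursive enlargement construction from the convexity proof for MLS:
-- `mlsStage M N s t n = (Vₙ, Mₙ)`, where
-- `V₀ = {u | t ∈ N u}`, `Vₙ₊₁ = {u | ∃ v ∈ Vₙ, M v ∈ M u}`,
-- `M₀ u = M u ∪ {s}` if `u ∈ V₀` and `M u` otherwise, and
-- `Mₙ₊₁ u = Mₙ u ∪ {Mₙ v | v ∈ Vₙ ∧ M v ∈ M u}` if `u ∈ Vₙ₊₁` and `Mₙ u` otherwise.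
open Classical in
noncomputable def mlsStage {ι : Type} [Fintype ι] (M N : ι → ZFSet) (s t : ZFSet) :
    ℕ → Set ι × (ι → ZFSet)
  | 0 => ({u | t ∈ N u}, fun u => if t ∈ N u then M u ∪ {s} else M u)
  | n + 1 =>
      let P := mlsStage M N s t n
      ({u | ∃ v ∈ P.1, M v ∈ M u},
        fun u =>
          if ∃ v ∈ P.1, M v ∈ M u then
            P.2 u ∪ ZFSet.range (fun v : {v : ι // v ∈ P.1 ∧ M v ∈ M u} => P.2 v.1)
          else P.2 u)

/-- `Vₙ`, the set of variables modified at stage `n`. -/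
noncomputable def mlsV {ι : Type} [Fintype ι] (M N : ι → ZFSet) (s t : ZFSet) (n : ℕ) :
    Set ι :=
  (mlsStage M N s t n).1

/-- `Mₙ`, the enlarged assignment at stage `n`. -/
noncomputable def mlsM {ι : Type} [Fintype ι] (M N : ι → ZFSet) (s t : ZFSet) (n : ℕ) :
    ι → ZFSet :=
  (mlsStage M N s t n).2

theorem mlsM_zero {ι : Type} [Fintype ι] (M N : ι → ZFSet) (s t : ZFSet) (u : ι) :
    mlsM M N s t 0 u = open Classical in if t ∈ N u then M u ∪ {s} else M u := rfl

theorem mlsM_succ {ι : Type} [Fintype ι] (M N : ι → ZFSet) (s t : ZFSet) (n : ℕ) (u : ι) :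
    mlsM M N s t (n + 1) u = open Classical in
      if ∃ v ∈ mlsV M N s t n, M v ∈ M u then
        mlsM M N s t n u ∪ ZFSet.range
          (fun v : {v : ι // v ∈ mlsV M N s t n ∧ M v ∈ M u} => mlsM M N s t n v.1)
      else mlsM M N s t n u := rfl

/-- The sets modified at stage `n` have rank greater than that of `s`. -/
theorem rank_lt_rank_mlsM {ι : Type} [Fintype ι] (M N : ι → ZFSet) (s t : ZFSet) (n : ℕ) :
    ∀ v ∈ mlsV M N s t n, s.rank < (mlsM M N s t n v).rank := by
  induction n with
  | zero =>
    intro v hv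
    have hv' : t ∈ N v := hv
    apply ZFSet.rank_lt_of_mem
    simp [mlsM_zero, hv']
  | succ n ih =>
    rintro v ⟨w, hw, hwv⟩
    refine (ih w hw).trans (ZFSet.rank_lt_of_mem ?_)
    rw [mlsM_succ, if_pos ⟨w, hw, hwv⟩, ZFSet.mem_union, ZFSet.mem_range]
    exact Or.inr ⟨⟨w, hw, hwv⟩, rfl⟩

/-- The enlargement does not change the elements of rank less than that of `s`. -/
theorem mem_mlsM_iff_of_rank_lt {ι : Type} [Fintype ι] (M N : ι → ZFSet) (s t : ZFSet)
    {z : ZFSet} (hz : z.rank < s.rank) (n : ℕ) (u : ι) : z ∈ mlsM M N s t n u ↔ z ∈ M u := by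
  induction n with
  | zero =>
    have hzs : z ≠ s := fun h => hz.ne (congrArg ZFSet.rank h)
    rw [mlsM_zero]
    split_ifs <;> simp [hzs]
  | succ n ih =>
    rw [mlsM_succ, ← ih]
    split_ifs
    · rw [ZFSet.mem_union, ZFSet.mem_range, or_iff_left]
      rintro ⟨⟨v, hv, _⟩, rfl⟩
      exact (rank_lt_rank_mlsM M N s t n v hv).not_gt hz
    · rfl

/-- Inequalities are preserved by the enlargement: if `M x ≠ M y` then `Mₙ x ≠ Mₙ y`
for every `n`. -/
theorem mlsM_ne_of_ne {ι : Type} [Fintype ι] (M N : ι → ZFSet) (s t : ZFSet)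
    (hrk : ∀ i : ι, (M i).rank < s.rank) :
    ∀ x y : ι, M x ≠ M y → ∀ n : ℕ, mlsM M N s t n x ≠ mlsM M N s t n y := by
  intro x y hxy n h
  refine hxy (ZFSet.ext fun z => ⟨fun hz => ?_, fun hz => ?_⟩)
  · have hzs := (ZFSet.rank_lt_of_mem hz).trans (hrk x)
    rwa [← mem_mlsM_iff_of_rank_lt M N s t hzs n, ← h, mem_mlsM_iff_of_rank_lt M N s t hzs n]
  · have hzs := (ZFSet.rank_lt_of_mem hz).trans (hrk y)
    rwa [← mem_mlsM_iff_of_rank_lt M N s t hzs n, h, mem_mlsM_iff_of_rank_lt M N s t hzs n]
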